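/- arXiv:1812.07766 — 2 statements merged into one kernel-verified Lean document; each statement's English description precedes it below -/
import Mathlib

section
/- Along any T²-symmetric Einstein flow, the correction Λ evolves by ∂_τ Λ = −2Λ − (1/2)⟨e^{−ρ} V_θ²⟩ + (1/2)⟨e^{ρ−2τ} V_τ²⟩ − (1/2)⟨V_τ⟩⟨e^{ρ−2τ} V_τ⟩ + (1/2) e^{−2τ} ∫_{S¹} e^{2(V−τ)+ρ} (Q_τ² − e^{2(τ−ρ)} Q_θ²)(V − ⟨V⟩ − 1) dθ. -/
noncomputable section

open Real MeasureTheory intervalIntegral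

/-- The θ-mean of a function on the circle of circumference 1 (total measure 1). -/
def circleMean (f : ℝ → ℝ) : ℝ := ∫ θ in (0:ℝ)..1, f θ

/-- The smooth, θ-periodic fields `V, Q, ρ, l` of a T²-symmetric spacetime in areal
coordinates; first argument is `τ`, second is `θ`. -/
structure T2Flow where
  V : ℝ → ℝ → ℝ
  Q : ℝ → ℝ → ℝ
  ρ : ℝ → ℝ → ℝ
  l : ℝ → ℝ → ℝ
  smooth_V : ContDiff ℝ (⊤ : ℕ∞) (Function.uncurry V)
  smooth_Q : ContDiff ℝ (⊤ : ℕ∞) (Function.uncurry Q)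
  smooth_ρ : ContDiff ℝ (⊤ : ℕ∞) (Function.uncurry ρ)
  smooth_l : ContDiff ℝ (⊤ : ℕ∞) (Function.uncurry l)
  periodic_V : ∀ τ, Function.Periodic (V τ) 1
  periodic_Q : ∀ τ, Function.Periodic (Q τ) 1
  periodic_ρ : ∀ τ, Function.Periodic (ρ τ) 1
  periodic_l : ∀ τ, Function.Periodic (l τ) 1

namespace T2Flow

/-- `V_τ`. -/
def Vτ (F : T2Flow) (τ θ : ℝ) : ℝ := deriv (fun s => F.V s θ) τ
/-- `V_θ`. -/
def Vθ (F : T2Flow) (τ θ : ℝ) : ℝ := deriv (fun x => F.V τ x) θ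
/-- `Q_τ`. -/
def Qτ (F : T2Flow) (τ θ : ℝ) : ℝ := deriv (fun s => F.Q s θ) τ
/-- `Q_θ`. -/
def Qθ (F : T2Flow) (τ θ : ℝ) : ℝ := deriv (fun x => F.Q τ x) θ
/-- `ρ_τ`. -/
def ρτ (F : T2Flow) (τ θ : ℝ) : ℝ := deriv (fun s => F.ρ s θ) τ
/-- `l_τ`. -/
def lτ (F : T2Flow) (τ θ : ℝ) : ℝ := deriv (fun s => F.l s θ) τ
/-- `l_θ`. -/
def lθ (F : T2Flow) (τ θ : ℝ) : ℝ := deriv (fun x => F.l τ x) θ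

/-- The energy density
`J = (1/2)[V_τ² + e^{2(τ−ρ)}V_θ² + e^{2(V−τ)}(Q_τ² + e^{2(τ−ρ)}Q_θ²)]`. -/
def J (F : T2Flow) (τ θ : ℝ) : ℝ :=
  (1/2) * (F.Vτ τ θ ^ 2 + exp (2*(τ - F.ρ τ θ)) * F.Vθ τ θ ^ 2
    + exp (2*(F.V τ θ - τ)) * (F.Qτ τ θ ^ 2 + exp (2*(τ - F.ρ τ θ)) * F.Qθ τ θ ^ 2))

/-- The T²-symmetric vacuum Einstein evolution equations together with the
momentum constraint. -/
def IsEinsteinFlow (F : T2Flow) : Prop :=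
  (∀ τ θ : ℝ, deriv (fun s => exp (F.ρ s θ) * F.Vτ s θ) τ
      = deriv (fun x => exp (2*τ - F.ρ τ x) * F.Vθ τ x) θ
        + exp (2*(F.V τ θ - τ) + F.ρ τ θ)
          * (F.Qτ τ θ ^ 2 - exp (2*(τ - F.ρ τ θ)) * F.Qθ τ θ ^ 2)) ∧
  (∀ τ θ : ℝ, deriv (fun s => exp (F.ρ s θ + 2*(F.V s θ - s)) * F.Qτ s θ) τ
      = deriv (fun x => exp (-F.ρ τ x + 2*F.V τ x) * F.Qθ τ x) θ) ∧
  (∀ τ θ : ℝ, F.lτ τ θ + F.ρτ τ θ + 2 = F.J τ θ) ∧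
  (∀ τ θ : ℝ, F.ρτ τ θ = exp (F.l τ θ)) ∧
  (∀ τ θ : ℝ, F.lθ τ θ = F.Vθ τ θ * F.Vτ τ θ
      + exp (2*(F.V τ θ - τ)) * F.Qθ τ θ * F.Qτ τ θ)

/-- The conserved quantity `A = ∫ e^ρ (V_τ − e^{2(V−τ)} Q_τ Q) dθ`. -/
def A (F : T2Flow) (τ : ℝ) : ℝ :=
  ∫ θ in (0:ℝ)..1,
    exp (F.ρ τ θ) * (F.Vτ τ θ - exp (2*(F.V τ θ - τ)) * F.Qτ τ θ * F.Q τ θ)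

/-- The conserved quantity `B = ∫ e^{ρ+2(V−τ)} Q_τ dθ`. -/
def B (F : T2Flow) (τ : ℝ) : ℝ :=
  ∫ θ in (0:ℝ)..1, exp (F.ρ τ θ + 2*(F.V τ θ - τ)) * F.Qτ τ θ

/-- The energy `E = ∫ e^{ρ−2τ} J dθ`. -/
def E (F : T2Flow) (τ : ℝ) : ℝ := ∫ θ in (0:ℝ)..1, exp (F.ρ τ θ - 2*τ) * F.J τ θ

/-- The `S¹`-volume `Π = ⟨e^ρ⟩`. -/
def Pi (F : T2Flow) (τ : ℝ) : ℝ := ∫ θ in (0:ℝ)..1, exp (F.ρ τ θ)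

/-- The correction `Λ = (1/2) e^{−2τ} ∫ V_τ (V − ⟨V⟩ − 1) e^ρ dθ`. -/
def Λ (F : T2Flow) (τ : ℝ) : ℝ :=
  (1/2) * exp (-2*τ) *
    ∫ θ in (0:ℝ)..1, F.Vτ τ θ * (F.V τ θ - circleMean (F.V τ) - 1) * exp (F.ρ τ θ)

/-- The corrected, normalized energy `H = Π (E + Λ)`. -/
def H (F : T2Flow) (τ : ℝ) : ℝ := F.Pi τ * (F.E τ + F.Λ τ)

/-- The twist potential `Y = ⟨e^{l+ρ+2τ}⟩`. -/
def Y (F : T2Flow) (τ : ℝ) : ℝ := ∫ θ in (0:ℝ)..1, exp (F.l τ θ + F.ρ τ θ + 2*τ)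

/-- The error term `Ω = ⟨e^{l+ρ+2τ} J⟩ − e^{2τ} E Y Π⁻¹`. -/
def Ω (F : T2Flow) (τ : ℝ) : ℝ :=
  (∫ θ in (0:ℝ)..1, exp (F.l τ θ + F.ρ τ θ + 2*τ) * F.J τ θ)
    - exp (2*τ) * F.E τ * F.Y τ / F.Pi τ

end T2Flow

open Function in
/-- A jointly smooth function is differentiable in its first argument. -/
theorem hasDerivAt_fst_of_contDiff {f : ℝ → ℝ → ℝ} (hf : ContDiff ℝ (⊤ : ℕ∞) (uncurry f))
    (s x : ℝ) : HasDerivAt (fun t => f t x) (deriv (fun t => f t x) s) s := by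
  have h : ContDiff ℝ (⊤ : ℕ∞) (fun t => f t x) :=
    hf.comp (contDiff_id.prodMk contDiff_const)
  exact (h.differentiable (by simp) s).hasDerivAt

open Function in
/-- A jointly smooth function is differentiable in its second argument. -/
theorem hasDerivAt_snd_of_contDiff {f : ℝ → ℝ → ℝ} (hf : ContDiff ℝ (⊤ : ℕ∞) (uncurry f))
    (s x : ℝ) : HasDerivAt (f s) (deriv (f s) x) x := by
  have h : ContDiff ℝ (⊤ : ℕ∞) (f s) :=
    hf.comp (contDiff_const.prodMk contDiff_id)
  exact (h.differentiable (by simp) x).hasDerivAt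

open Function in
/-- The derivative of a jointly smooth function in its first argument is jointly smooth. -/
theorem contDiff_deriv_fst {f : ℝ → ℝ → ℝ} (hf : ContDiff ℝ (⊤ : ℕ∞) (uncurry f)) :
    ContDiff ℝ (⊤ : ℕ∞) (uncurry fun s x => deriv (fun t => f t x) s) := by
  have h : (uncurry fun s x => deriv (fun t => f t x) s)
      = fun p => fderiv ℝ (uncurry f) p (1, 0) := by
    ext ⟨s, x⟩
    exact ((hf.differentiable (by simp) (s, x)).hasFDerivAt.comp_hasDerivAt s
      ((hasDerivAt_id s).prodMk (hasDerivAt_const s x))).deriv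
  rw [h]
  exact (hf.fderiv_right (by simp)).clm_apply contDiff_const

open Function in
/-- The derivative of a jointly smooth function in its second argument is jointly smooth. -/
theorem contDiff_deriv_snd {f : ℝ → ℝ → ℝ} (hf : ContDiff ℝ (⊤ : ℕ∞) (uncurry f)) :
    ContDiff ℝ (⊤ : ℕ∞) (uncurry fun s x => deriv (f s) x) := by
  have h : (uncurry fun s x => deriv (f s) x)
      = fun p => fderiv ℝ (uncurry f) p (0, 1) := by
    ext ⟨s, x⟩
    exact ((hf.differentiable (by simp) (s, x)).hasFDerivAt.comp_hasDerivAt x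
      ((hasDerivAt_const x s).prodMk (hasDerivAt_id x))).deriv
  rw [h]
  exact (hf.fderiv_right (by simp)).clm_apply contDiff_const

open Function in
/-- Differentiation under the integral sign for a jointly smooth integrand. -/
theorem hasDerivAt_integral_of_contDiff {f : ℝ → ℝ → ℝ}
    (hf : ContDiff ℝ (⊤ : ℕ∞) (uncurry f)) (a b s : ℝ) :
    HasDerivAt (fun t => ∫ x in a..b, f t x) (∫ x in a..b, deriv (fun t => f t x) s) s := by
  have hf' := (contDiff_deriv_fst hf).continuous
  obtain ⟨C, hC⟩ := ((isCompact_closedBall s 1).prod (isCompact_uIcc (a := a) (b := b)))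
    |>.exists_bound_of_continuousOn hf'.continuousOn
  have hcont (t : ℝ) : Continuous (f t) := hf.continuous.comp (by fun_prop : Continuous fun x : ℝ => (t, x))
  have hcont' : Continuous (fun x => deriv (fun t => f t x) s) :=
    hf'.comp (by fun_prop : Continuous fun x : ℝ => (s, x))
  refine (hasDerivAt_integral_of_dominated_loc_of_deriv_le (bound := fun _ => C)
    (F' := fun s x => deriv (fun t => f t x) s)
    (Metric.closedBall_mem_nhds s one_pos) (.of_forall fun t => (hcont t).aestronglyMeasurable)
    ((hcont s).intervalIntegrable _ _) hcont'.aestronglyMeasurable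
    (.of_forall fun x hx t ht => hC (t, x) ⟨ht, Set.uIoc_subset_uIcc hx⟩)
    intervalIntegrable_const
    (.of_forall fun x _ t _ => hasDerivAt_fst_of_contDiff hf t x)).2

/-- The derivative of a periodic function is periodic. -/
theorem Function.Periodic.deriv_periodic {f : ℝ → ℝ} {c : ℝ} (hf : Function.Periodic f c) :
    Function.Periodic (deriv f) c := fun x => by
  rw [← deriv_comp_add_const, hf.funext]

/-- Integration by parts over one period, without boundary terms. -/
theorem integral_deriv_mul_of_periodic {f g f' g' : ℝ → ℝ}
    (hf : Function.Periodic f 1) (hg : Function.Periodic g 1)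
    (hf' : ∀ x, HasDerivAt f (f' x) x) (hg' : ∀ x, HasDerivAt g (g' x) x)
    (cf : Continuous f') (cg : Continuous g') :
    ∫ x in (0:ℝ)..1, f' x * g x = -∫ x in (0:ℝ)..1, f x * g' x := by
  rw [integral_mul_deriv_eq_deriv_mul (fun x _ => hf' x) (fun x _ => hg' x)
    (cf.intervalIntegrable _ _) (cg.intervalIntegrable _ _), hf.eq, hg.eq]
  ring

/-- Evolution of the correction `Λ` along any T²-symmetric Einstein flow. -/
theorem correction_evolution (F : T2Flow) (hF : F.IsEinsteinFlow) (τ : ℝ) :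
    deriv F.Λ τ
      = -2 * F.Λ τ
        - (1/2) * circleMean (fun θ => Real.exp (-(F.ρ τ θ)) * F.Vθ τ θ ^ 2)
        + (1/2) * circleMean (fun θ => Real.exp (F.ρ τ θ - 2*τ) * F.Vτ τ θ ^ 2)
        - (1/2) * circleMean (fun θ => F.Vτ τ θ)
            * circleMean (fun θ => Real.exp (F.ρ τ θ - 2*τ) * F.Vτ τ θ)
        + (1/2) * Real.exp (-2*τ) * ∫ θ in (0:ℝ)..1,
            Real.exp (2*(F.V τ θ - τ) + F.ρ τ θ)
              * (F.Qτ τ θ ^ 2 - Real.exp (2*(τ - F.ρ τ θ)) * F.Qθ τ θ ^ 2)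
              * (F.V τ θ - circleMean (F.V τ) - 1) := by
  have hV := F.smooth_V
  have hVτ : ContDiff ℝ (⊤ : ℕ∞) (Function.uncurry F.Vτ) := contDiff_deriv_fst hV
  have hVθ : ContDiff ℝ (⊤ : ℕ∞) (Function.uncurry F.Vθ) := contDiff_deriv_snd hV
  have hW : ContDiff ℝ (⊤ : ℕ∞) (Function.uncurry fun s x => exp (F.ρ s x) * F.Vτ s x) :=
    F.smooth_ρ.exp.mul hVτ
  have hWV : ContDiff ℝ (⊤ : ℕ∞)
      (Function.uncurry fun s x => exp (F.ρ s x) * F.Vτ s x * F.V s x) := hW.mul hV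
  have hflux : ContDiff ℝ (⊤ : ℕ∞)
      (Function.uncurry fun s x => exp (2 * s - F.ρ s x) * F.Vθ s x) :=
    ((contDiff_const.mul contDiff_fst).sub F.smooth_ρ).exp.mul hVθ
  have slice {f : ℝ → ℝ → ℝ} (hf : ContDiff ℝ (⊤ : ℕ∞) (Function.uncurry f)) (s : ℝ) :
      Continuous (f s) := hf.continuous.comp (by fun_prop : Continuous fun x : ℝ => (s, x))
  have cV (s : ℝ) := slice hV s
  have cVτ (s : ℝ) := slice hVτ s
  have cVθ (s : ℝ) := slice hVθ s
  have cρ (s : ℝ) := slice F.smooth_ρ s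
  have cQτ := slice (contDiff_deriv_fst F.smooth_Q) τ
  have cQθ := slice (contDiff_deriv_snd F.smooth_Q) τ
  have cW' := slice (contDiff_deriv_fst hW) τ
  have cWV' := slice (contDiff_deriv_fst hWV) τ
  have cflux' := slice (contDiff_deriv_snd hflux) τ
  change Continuous (F.Qτ τ) at cQτ
  change Continuous (F.Qθ τ) at cQθ
  set m := circleMean (F.V τ) with hm
  set S : ℝ → ℝ := fun θ => exp (2*(F.V τ θ - τ) + F.ρ τ θ)
    * (F.Qτ τ θ ^ 2 - exp (2*(τ - F.ρ τ θ)) * F.Qθ τ θ ^ 2)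
  have cS : Continuous S := by fun_prop
  have hmean : HasDerivAt (fun s => circleMean (F.V s)) (circleMean (F.Vτ τ)) τ :=
    hasDerivAt_integral_of_contDiff hV 0 1 τ
  have hΛ : F.Λ = fun s => (1/2) * exp (-2*s) *
      ((∫ θ in (0:ℝ)..1, exp (F.ρ s θ) * F.Vτ s θ * F.V s θ)
        - (circleMean (F.V s) + 1) * ∫ θ in (0:ℝ)..1, exp (F.ρ s θ) * F.Vτ s θ) := by
    ext s
    rw [T2Flow.Λ, ← intervalIntegral.integral_const_mul (circleMean (F.V s) + 1), ← intervalIntegral.integral_sub]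
    · congr 2; ext θ; ring
    all_goals exact Continuous.intervalIntegrable (by fun_prop) _ _
  have hexp : HasDerivAt (fun s : ℝ => (1/2) * exp (-2*s)) ((1/2) * (exp (-2*τ) * (-2))) τ := by
    simpa only [id, mul_one] using (((hasDerivAt_id τ).const_mul (-2)).exp).const_mul (1/2)
  have hprod (θ : ℝ) : deriv (fun s => exp (F.ρ s θ) * F.Vτ s θ * F.V s θ) τ
      = deriv (fun s => exp (F.ρ s θ) * F.Vτ s θ) τ * F.V τ θ
        + exp (F.ρ τ θ) * F.Vτ τ θ * F.Vτ τ θ :=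
    ((hasDerivAt_fst_of_contDiff hW τ θ).mul (hasDerivAt_fst_of_contDiff hV τ θ)).deriv
  have hderiv := hexp.mul ((hasDerivAt_integral_of_contDiff hWV 0 1 τ).sub
    ((hmean.add_const 1).mul (hasDerivAt_integral_of_contDiff hW 0 1 τ)))
  have hparts : ∫ θ in (0:ℝ)..1,
        deriv (fun x => exp (2*τ - F.ρ τ x) * F.Vθ τ x) θ * (F.V τ θ - m - 1)
      = -∫ θ in (0:ℝ)..1, exp (2*τ - F.ρ τ θ) * F.Vθ τ θ * F.Vθ τ θ := by
    refine integral_deriv_mul_of_periodic (fun x => ?_) (fun x => ?_)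
      (hasDerivAt_snd_of_contDiff hflux τ)
      (fun x => ((hasDerivAt_snd_of_contDiff hV τ x).sub_const m).sub_const 1) cflux' (cVθ τ)
    · have h : F.Vθ τ (x + 1) = F.Vθ τ x := (F.periodic_V τ).deriv_periodic x
      simp only [h, F.periodic_ρ τ x]
    · simp only [F.periodic_V τ x]
  have hsplit : (∫ θ in (0:ℝ)..1, deriv (fun s => exp (F.ρ s θ) * F.Vτ s θ * F.V s θ) τ)
        - (m + 1) * ∫ θ in (0:ℝ)..1, deriv (fun s => exp (F.ρ s θ) * F.Vτ s θ) τ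
      = (-∫ θ in (0:ℝ)..1, exp (2*τ - F.ρ τ θ) * F.Vθ τ θ * F.Vθ τ θ)
        + (∫ θ in (0:ℝ)..1, S θ * (F.V τ θ - m - 1))
        + ∫ θ in (0:ℝ)..1, exp (F.ρ τ θ) * F.Vτ τ θ * F.Vτ τ θ := by
    rw [← hparts, ← intervalIntegral.integral_const_mul, ← intervalIntegral.integral_sub, ← intervalIntegral.integral_add, ← intervalIntegral.integral_add]
    · congr 1; ext θ
      rw [hprod, hF.1 τ θ]
      ring
    all_goals exact Continuous.intervalIntegrable (by fun_prop) _ _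
  have hscale (f : ℝ → ℝ) : circleMean (fun θ => exp (F.ρ τ θ - 2*τ) * f θ)
      = exp (-2*τ) * ∫ θ in (0:ℝ)..1, exp (F.ρ τ θ) * f θ := by
    rw [circleMean, ← intervalIntegral.integral_const_mul]
    congr 1; ext θ
    rw [sub_eq_add_neg, exp_add, neg_mul]; ring
  have hgrad : circleMean (fun θ => exp (-(F.ρ τ θ)) * F.Vθ τ θ ^ 2)
      = exp (-2*τ) * ∫ θ in (0:ℝ)..1, exp (2*τ - F.ρ τ θ) * F.Vθ τ θ * F.Vθ τ θ := by
    rw [circleMean, ← intervalIntegral.integral_const_mul]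
    congr 1; ext θ
    rw [show -(F.ρ τ θ) = -2*τ + (2*τ - F.ρ τ θ) by ring, exp_add]; ring
  have hkin : ∫ θ in (0:ℝ)..1, exp (F.ρ τ θ) * F.Vτ τ θ ^ 2
      = ∫ θ in (0:ℝ)..1, exp (F.ρ τ θ) * F.Vτ τ θ * F.Vτ τ θ := by
    congr 1; ext θ; ring
  have hd := hderiv.deriv
  rw [hscale, hscale, hgrad, hkin]
  simp only [hΛ]
  refine hd.trans ?_
  simp only [Pi.mul_apply, Pi.sub_apply, ← hm]
  linear_combination (1/2) * exp (-2*τ) * hsplit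
end
end

section
/- Along any T²-symmetric Einstein flow, at every time τ one has |Λ + ⟨(1/2) e^{ρ−2τ} V_τ⟩| = |(1/2) e^{−2τ} ∫_{S¹} V_τ (V − ⟨V⟩) e^ρ dθ| ≲ e^{−τ} Π E. -/
noncomputable section

open Real MeasureTheory intervalIntegral

/-- The partial derivative in the first variable of a smooth function is continuous in the
second variable. -/
theorem continuous_deriv_fst {u : ℝ → ℝ → ℝ}
    (hu : ContDiff ℝ (⊤ : ℕ∞) (Function.uncurry u)) (τ : ℝ) :
    Continuous fun θ => deriv (fun s => u s θ) τ := by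
  have key : ∀ θ, deriv (fun s => u s θ) τ = fderiv ℝ (Function.uncurry u) (τ, θ) (1, 0) := by
    intro θ
    have h1 : HasFDerivAt (Function.uncurry u) (fderiv ℝ (Function.uncurry u) (τ, θ)) (τ, θ) :=
      (hu.differentiable (by simp) (τ, θ)).hasFDerivAt
    have h2 : HasDerivAt (fun s : ℝ => (s, θ)) ((1 : ℝ), (0 : ℝ)) τ :=
      (hasDerivAt_id τ).prodMk (hasDerivAt_const τ θ)
    exact (h1.comp_hasDerivAt τ h2).deriv
  simp_rw [key]
  have h3 : Continuous (fderiv ℝ (Function.uncurry u)) := hu.continuous_fderiv (by simp)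
  exact (h3.comp (by fun_prop : Continuous fun θ : ℝ => (τ, θ))).clm_apply continuous_const

theorem contDiff_slice {u : ℝ → ℝ → ℝ}
    (hu : ContDiff ℝ (⊤ : ℕ∞) (Function.uncurry u)) (τ : ℝ) :
    ContDiff ℝ (⊤ : ℕ∞) (u τ) :=
  hu.comp (by fun_prop : ContDiff ℝ (⊤ : ℕ∞) fun θ : ℝ => (τ, θ))

/-- The oscillation of a `C¹` function about its mean is at most its total variation. -/
theorem abs_sub_circleMean_le {f : ℝ → ℝ} (hf : ContDiff ℝ 1 f) {θ : ℝ}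
    (hθ : θ ∈ Set.Icc (0 : ℝ) 1) :
    |f θ - circleMean f| ≤ ∫ x in (0 : ℝ)..1, |deriv f x| := by
  have hd : Continuous (deriv f) := hf.continuous_deriv (by simp)
  have hosc : ∀ φ ∈ Set.uIoc (0 : ℝ) 1, ‖f θ - f φ‖ ≤ ∫ x in (0 : ℝ)..1, |deriv f x| := by
    intro φ hφ
    rw [Set.uIoc_of_le zero_le_one] at hφ
    rw [← integral_deriv_eq_sub (fun x _ => hf.differentiable (by simp) x)
      (hd.intervalIntegrable φ θ)]
    refine (norm_integral_le_integral_norm_uIoc).trans ?_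
    rw [integral_of_le zero_le_one]
    refine setIntegral_mono_set ?_ (Filter.Eventually.of_forall fun x => abs_nonneg _) ?_
    · exact (intervalIntegrable_iff_integrableOn_Ioc_of_le zero_le_one).1
        (hd.abs.intervalIntegrable 0 1)
    · exact (Set.Ioc_subset_Ioc (le_min hφ.1.le hθ.1) (max_le hφ.2 hθ.2)).eventuallyLE
  have hmean : f θ - circleMean f = ∫ φ in (0 : ℝ)..1, (f θ - f φ) := by
    rw [integral_sub (continuous_const.intervalIntegrable 0 1)
      (hf.continuous.intervalIntegrable 0 1)]
    simp [circleMean]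
  rw [hmean]
  simpa using norm_integral_le_of_norm_le_const hosc

/-- The Cauchy–Schwarz inequality for a positive continuous weight. -/
theorem sq_integral_mul_le {r p : ℝ → ℝ} (hr : Continuous r) (hp : Continuous p)
    (hpos : ∀ x, 0 < r x) :
    (∫ x in (0 : ℝ)..1, r x * p x) ^ 2
      ≤ (∫ x in (0 : ℝ)..1, r x) * ∫ x in (0 : ℝ)..1, r x * p x ^ 2 := by
  have hR : 0 < ∫ x in (0 : ℝ)..1, r x :=
    intervalIntegral_pos_of_pos (hr.intervalIntegrable 0 1) hpos zero_lt_one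
  set R := ∫ x in (0 : ℝ)..1, r x with hRdef
  set P := ∫ x in (0 : ℝ)..1, r x * p x with hPdef
  set S := ∫ x in (0 : ℝ)..1, r x * p x ^ 2 with hSdef
  have h0 : 0 ≤ ∫ x in (0 : ℝ)..1, r x * (R * p x - P) ^ 2 :=
    integral_nonneg zero_le_one fun x _ => mul_nonneg (hpos x).le (sq_nonneg _)
  have h1 : ∫ x in (0 : ℝ)..1, r x * (R * p x - P) ^ 2 = R * (R * S - P ^ 2) := by
    have : ∀ x, r x * (R * p x - P) ^ 2
        = R ^ 2 * (r x * p x ^ 2) - 2 * R * P * (r x * p x) + P ^ 2 * r x := fun x => by ring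
    simp_rw [this]
    rw [integral_add (Continuous.intervalIntegrable (by fun_prop) 0 1)
        (Continuous.intervalIntegrable (by fun_prop) 0 1),
      integral_sub (Continuous.intervalIntegrable (by fun_prop) 0 1)
        (Continuous.intervalIntegrable (by fun_prop) 0 1),
      intervalIntegral.integral_const_mul, intervalIntegral.integral_const_mul, intervalIntegral.integral_const_mul, ← hRdef, ← hPdef, ← hSdef]
    ring
  rw [h1] at h0
  linarith [nonneg_of_mul_nonneg_right h0 hR]

namespace T2Flow

variable (F : T2Flow) (τ : ℝ)

theorem continuous_V : Continuous (F.V τ) := (contDiff_slice F.smooth_V τ).continuous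

theorem continuous_ρ : Continuous (F.ρ τ) := (contDiff_slice F.smooth_ρ τ).continuous

theorem continuous_Vτ : Continuous (F.Vτ τ) := continuous_deriv_fst F.smooth_V τ

theorem continuous_Qτ : Continuous (F.Qτ τ) := continuous_deriv_fst F.smooth_Q τ

theorem continuous_Vθ : Continuous (F.Vθ τ) :=
  (contDiff_slice F.smooth_V τ).continuous_deriv (by simp)

theorem continuous_Qθ : Continuous (F.Qθ τ) :=
  (contDiff_slice F.smooth_Q τ).continuous_deriv (by simp)

theorem continuous_J : Continuous (F.J τ) := by
  have hV := F.continuous_V τ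
  have hρ := F.continuous_ρ τ
  have hVτ := F.continuous_Vτ τ
  have hVθ := F.continuous_Vθ τ
  have hQτ := F.continuous_Qτ τ
  have hQθ := F.continuous_Qθ τ
  unfold J
  fun_prop

theorem Λ_add_circleMean :
    F.Λ τ + circleMean (fun θ => (1/2) * exp (F.ρ τ θ - 2*τ) * F.Vτ τ θ)
      = (1/2) * exp (-2*τ)
          * ∫ θ in (0:ℝ)..1, F.Vτ τ θ * (F.V τ θ - circleMean (F.V τ)) * exp (F.ρ τ θ) := by
  have hV := F.continuous_V τ
  have hρ := F.continuous_ρ τ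
  have hVτ := F.continuous_Vτ τ
  have h1 : ∀ θ, (1/2) * exp (F.ρ τ θ - 2*τ) * F.Vτ τ θ
      = (1/2) * exp (-2*τ) * (F.Vτ τ θ * exp (F.ρ τ θ)) := fun θ => by
    rw [show F.ρ τ θ - 2*τ = F.ρ τ θ + -2*τ by ring, exp_add]
    ring
  unfold Λ
  simp_rw [h1]
  rw [circleMean.eq_def fun θ => (1/2) * exp (-2*τ) * (F.Vτ τ θ * exp (F.ρ τ θ)),
    intervalIntegral.integral_const_mul, ← mul_add,
    ← integral_add (Continuous.intervalIntegrable (by fun_prop) 0 1)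
      (Continuous.intervalIntegrable (by fun_prop) 0 1)]
  congr 2
  ext θ
  ring

/-- The `V`-part of the energy is bounded by the whole energy. -/
theorem integral_sq_add_le_E :
    (∫ θ in (0:ℝ)..1, exp (F.ρ τ θ) * |F.Vτ τ θ| ^ 2)
      + (∫ θ in (0:ℝ)..1, exp (F.ρ τ θ) * (exp (τ - F.ρ τ θ) * |F.Vθ τ θ|) ^ 2)
      ≤ 2 * exp (2*τ) * F.E τ := by
  have hρ := F.continuous_ρ τ
  have hVτ := F.continuous_Vτ τ
  have hVθ := F.continuous_Vθ τ
  have hJ := F.continuous_J τ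
  unfold E
  rw [← intervalIntegral.integral_const_mul, ← integral_add (Continuous.intervalIntegrable (by fun_prop) 0 1)
      (Continuous.intervalIntegrable (by fun_prop) 0 1)]
  refine integral_mono_on zero_le_one (Continuous.intervalIntegrable (by fun_prop) 0 1)
    (Continuous.intervalIntegrable (by fun_prop) 0 1) fun θ _ => ?_
  have h1 : exp (2*τ) * exp (F.ρ τ θ - 2*τ) = exp (F.ρ τ θ) := by
    rw [← exp_add]
    ring_nf
  have h2 : exp (2*(τ - F.ρ τ θ)) = exp (τ - F.ρ τ θ) ^ 2 := by
    rw [← exp_nat_mul]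
    norm_num
  have h3 : 0 ≤ exp (F.ρ τ θ) * (exp (2*(F.V τ θ - τ))
      * (F.Qτ τ θ ^ 2 + exp (2*(τ - F.ρ τ θ)) * F.Qθ τ θ ^ 2)) := by positivity
  have h4 : 2 * exp (2*τ) * (exp (F.ρ τ θ - 2*τ) * F.J τ θ)
      = exp (F.ρ τ θ) * (2 * F.J τ θ) := by
    rw [← h1]
    ring
  rw [h4, J, mul_pow, sq_abs, sq_abs, ← h2]
  linarith

theorem abs_integral_Vτ_mul_le :
    |∫ θ in (0:ℝ)..1, F.Vτ τ θ * (F.V τ θ - circleMean (F.V τ)) * exp (F.ρ τ θ)|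
      ≤ (∫ θ in (0:ℝ)..1, exp (F.ρ τ θ) * |F.Vτ τ θ|) * ∫ θ in (0:ℝ)..1, |F.Vθ τ θ| := by
  have hV := F.continuous_V τ
  have hρ := F.continuous_ρ τ
  have hVτ := F.continuous_Vτ τ
  refine (abs_integral_le_integral_abs zero_le_one).trans ?_
  rw [← intervalIntegral.integral_mul_const]
  refine integral_mono_on zero_le_one (Continuous.intervalIntegrable (by fun_prop) 0 1)
    (Continuous.intervalIntegrable (by fun_prop) 0 1) fun θ hθ => ?_
  have hosc : |F.V τ θ - circleMean (F.V τ)| ≤ ∫ θ in (0:ℝ)..1, |F.Vθ τ θ| :=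
    abs_sub_circleMean_le ((contDiff_slice F.smooth_V τ).of_le (by simp)) hθ
  rw [abs_mul, abs_mul, abs_of_pos (exp_pos _)]
  calc |F.Vτ τ θ| * |F.V τ θ - circleMean (F.V τ)| * exp (F.ρ τ θ)
      = exp (F.ρ τ θ) * |F.Vτ τ θ| * |F.V τ θ - circleMean (F.V τ)| := by ring
    _ ≤ _ := mul_le_mul_of_nonneg_left hosc (by positivity)

theorem abs_Λ_add_circleMean_le :
    |F.Λ τ + circleMean (fun θ => (1/2) * exp (F.ρ τ θ - 2*τ) * F.Vτ τ θ)|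
      ≤ 1/2 * (exp (-τ) * (F.Pi τ * F.E τ)) := by
  have hρ := F.continuous_ρ τ
  have hVτ := F.continuous_Vτ τ
  have hVθ := F.continuous_Vθ τ
  have hint := F.abs_integral_Vτ_mul_le τ
  have hE := F.integral_sq_add_le_E τ
  have hPi : 0 ≤ F.Pi τ := integral_nonneg zero_le_one fun _ _ => (exp_pos _).le
  have hN := sq_integral_mul_le (r := fun θ => exp (F.ρ τ θ)) (p := fun θ => |F.Vτ τ θ|)
    (by fun_prop) (by fun_prop) fun _ => exp_pos _
  have hM := sq_integral_mul_le (r := fun θ => exp (F.ρ τ θ))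
    (p := fun θ => exp (τ - F.ρ τ θ) * |F.Vθ τ θ|)
    (by fun_prop) (by fun_prop) fun _ => exp_pos _
  have hMeq : ∀ θ, exp (F.ρ τ θ) * (exp (τ - F.ρ τ θ) * |F.Vθ τ θ|)
      = exp τ * |F.Vθ τ θ| := fun θ => by
    rw [← mul_assoc, ← exp_add]
    ring_nf
  simp_rw [hMeq] at hM
  rw [intervalIntegral.integral_const_mul] at hM
  rw [← Pi.eq_def] at hN hM
  rw [F.Λ_add_circleMean τ, abs_mul, abs_of_pos (by positivity)]
  set N := ∫ θ in (0:ℝ)..1, exp (F.ρ τ θ) * |F.Vτ τ θ|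
  set M := ∫ θ in (0:ℝ)..1, |F.Vθ τ θ|
  have hNM : exp τ * (N * M) ≤ F.Pi τ * (exp (2*τ) * F.E τ) := by
    nlinarith [two_mul_le_add_sq N (exp τ * M), mul_le_mul_of_nonneg_left hE hPi]
  have e1 : exp (-2*τ) = exp (-3*τ) * exp τ := by rw [← exp_add]; ring_nf
  have e2 : exp (-τ) = exp (-3*τ) * exp (2*τ) := by rw [← exp_add]; ring_nf
  calc _ ≤ (1/2) * exp (-2*τ) * (N * M) := mul_le_mul_of_nonneg_left hint (by positivity)
    _ = (1/2) * (exp (-3*τ) * (exp τ * (N * M))) := by rw [e1]; ring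
    _ ≤ (1/2) * (exp (-3*τ) * (F.Pi τ * (exp (2*τ) * F.E τ))) := by gcongr
    _ = 1/2 * (exp (-τ) * (F.Pi τ * F.E τ)) := by rw [e2]; ring

end T2Flow

/-- `|Λ + ⟨(1/2)e^{ρ−2τ}V_τ⟩| = |(1/2)e^{−2τ}∫ V_τ (V − ⟨V⟩) e^ρ dθ| ≲ e^{−τ} Π E`. -/
theorem correction_bound_one :
    ∃ C : ℝ, 0 < C ∧ ∀ (F : T2Flow), F.IsEinsteinFlow → ∀ τ : ℝ,
      |F.Λ τ + circleMean (fun θ => (1/2) * Real.exp (F.ρ τ θ - 2*τ) * F.Vτ τ θ)|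
        = |(1/2) * Real.exp (-2*τ)
            * ∫ θ in (0:ℝ)..1, F.Vτ τ θ * (F.V τ θ - circleMean (F.V τ)) * Real.exp (F.ρ τ θ)|
      ∧ |F.Λ τ + circleMean (fun θ => (1/2) * Real.exp (F.ρ τ θ - 2*τ) * F.Vτ τ θ)|
          ≤ C * (Real.exp (-τ) * (F.Pi τ * F.E τ)) := by
  exact ⟨1/2, by norm_num, fun F _ τ =>
    ⟨congrArg _ (F.Λ_add_circleMean τ), F.abs_Λ_add_circleMean_le τ⟩⟩
end
end
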